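/- Let d ≥ 1 and s ≥ 2 be integers. There is a constant C > 0 depending only on d and s such that the following holds. Let q be an odd prime power whose characteristic does not divide s, let P(x) = ∑_{j=1}^d a_j x_j^s with all a_j ∈ F_q∖{0}, let E ⊆ F_q^d, X ⊆ F_q, and let k ≥ 3 be an odd integer. Then ∑_{t∈F_q} ν_{P,k}(t)² ≤ |X|²·|E|^{2k}/q + C·q^d·|X|·Λ_{k−1}(E)·Λ_{k+1}(E). -/

import Mathlib

open Finset

/-- The `k`-energy `Λ_k(E)` of a set `E` (intended for even `k = 2m`): the number of
`k`-tuples from `E` whose first `k/2` entries and last `k/2` entries have equal sums. -/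
noncomputable def energy {G : Type} [AddCommMonoid G] (E : Finset G) (k : ℕ) : ℕ :=
  Nat.card {x : Fin k → G // (∀ i, x i ∈ E) ∧
    (∑ i ∈ Finset.univ.filter (fun i : Fin k => (i : ℕ) < k / 2), x i) =
    (∑ i ∈ Finset.univ.filter (fun i : Fin k => ¬ (i : ℕ) < k / 2), x i)}

/-- `ν_{P,k}(t)` for the diagonal polynomial `P(x) = ∑_j a j * x_j ^ s`: the number of tuples
`(b, x¹, …, x^k) ∈ X × E^k` with `b + P(x¹ + ⋯ + x^k) = t`. -/
noncomputable def nuP {F : Type} [Field F] [Fintype F] {d : ℕ} (a : Fin d → F) (s : ℕ)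
    (E : Finset (Fin d → F)) (X : Finset F) (k : ℕ) (t : F) : ℕ :=
  Nat.card {p : F × (Fin k → (Fin d → F)) // p.1 ∈ X ∧ (∀ i, p.2 i ∈ E) ∧
    p.1 + ∑ j, a j * ((∑ i, p.2 i) j) ^ s = t}

section PowerSums

open Polynomial

variable {A B : Type*} [Field A] [Field B]

/-- The generating series `∑_{k ≥ 1} p_k T^k` of the power sums of the roots of a monic
polynomial, as a logarithmic derivative of the reversed polynomial. -/
noncomputable def powerSumSeries (g : A[X]) : PowerSeries A :=
  -(PowerSeries.X * PowerSeries.derivative A (g.reverse : PowerSeries A)) *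
    (g.reverse : PowerSeries A)⁻¹

lemma constantCoeff_reverse {g : A[X]} (hg : g.Monic) :
    PowerSeries.constantCoeff (g.reverse : PowerSeries A) = 1 := by
  simp [← PowerSeries.coeff_zero_eq_constantCoeff_apply, hg]

lemma powerSumSeries_mul_reverse {g : A[X]} (hg : g.Monic) :
    powerSumSeries g * (g.reverse : PowerSeries A) =
      -(PowerSeries.X * PowerSeries.derivative A (g.reverse : PowerSeries A)) := by
  rw [powerSumSeries, mul_assoc, PowerSeries.inv_mul_cancel _ (by
    rw [constantCoeff_reverse hg]; exact one_ne_zero), mul_one]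

lemma reverse_coe_ne_zero {g : A[X]} (hg : g.Monic) : (g.reverse : PowerSeries A) ≠ 0 := by
  intro h
  have := constantCoeff_reverse hg
  simp [h] at this

lemma eq_powerSumSeries {g : A[X]} (hg : g.Monic) {W : PowerSeries A}
    (hW : W * (g.reverse : PowerSeries A) =
      -(PowerSeries.X * PowerSeries.derivative A (g.reverse : PowerSeries A))) :
    W = powerSumSeries g :=
  mul_right_cancel₀ (reverse_coe_ne_zero hg) (hW.trans (powerSumSeries_mul_reverse hg).symm)

lemma powerSumSeries_mul {g h : A[X]} (hg : g.Monic) (hh : h.Monic) :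
    powerSumSeries (g * h) = powerSumSeries g + powerSumSeries h := by
  symm
  apply eq_powerSumSeries (hg.mul hh)
  rw [reverse_mul_of_domain, Polynomial.coe_mul, Derivation.leibniz, smul_eq_mul, smul_eq_mul]
  linear_combination (h.reverse : PowerSeries A) * powerSumSeries_mul_reverse hg +
    (g.reverse : PowerSeries A) * powerSumSeries_mul_reverse hh

lemma powerSumSeries_one : powerSumSeries (1 : A[X]) = 0 := by
  symm
  apply eq_powerSumSeries monic_one
  have : (1 : A[X]).reverse = 1 := by simpa using reverse_C (1 : A)
  simp [this]

lemma powerSumSeries_X_sub_C (a : A) :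
    powerSumSeries (X - C a) = PowerSeries.mk fun k => if k = 0 then 0 else a ^ k := by
  symm
  apply eq_powerSumSeries (monic_X_sub_C a)
  have h : (X - C a).reverse = 1 - C a * X := by
    have := reverse_add_C (X : A[X]) (-a)
    have h2 : (X : A[X]).reverse = 1 := by
      simpa [reverse_C] using reverse_mul_X (1 : A[X]) |>.trans (by simpa using reverse_C (1 : A))
    simp only [C_neg, ← sub_eq_add_neg, natDegree_X, pow_one, h2] at this
    rw [this]; ring
  have hr : ((X - C a).reverse : PowerSeries A) = 1 - PowerSeries.C a * PowerSeries.X := by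
    rw [h]; simp
  have hd : PowerSeries.derivative A (1 - PowerSeries.C a * PowerSeries.X) = -PowerSeries.C a := by
    simp
  rw [hr, hd, mul_sub, mul_one, mul_neg, neg_neg, mul_left_comm]
  ext n
  rcases n with _ | _ | n
  · simp
  · simp [PowerSeries.coeff_succ_mul_X, PowerSeries.coeff_succ_X_mul]
  · simp [PowerSeries.coeff_succ_mul_X, PowerSeries.coeff_X, pow_succ']

lemma powerSumSeries_map (φ : A →+* B) {g : A[X]} (hg : g.Monic) :
    powerSumSeries (g.map φ) = PowerSeries.map φ (powerSumSeries g) := by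
  symm
  apply eq_powerSumSeries (hg.map φ)
  have h : ((g.map φ).reverse : PowerSeries B) = PowerSeries.map φ (g.reverse : PowerSeries A) := by
    ext n
    simp [reverse, reflect_map]
  have hd : PowerSeries.derivative B (PowerSeries.map φ (g.reverse : PowerSeries A)) =
      PowerSeries.map φ (PowerSeries.derivative A (g.reverse : PowerSeries A)) := by
    ext n
    simp [PowerSeries.coeff_derivative]
  rw [h, hd, ← map_mul, powerSumSeries_mul_reverse hg]
  simp

/-- The `k`-th power sum of the roots of a monic polynomial (for `k ≥ 1`). -/
noncomputable def rootPowerSum (k : ℕ) (g : A[X]) : A := PowerSeries.coeff k (powerSumSeries g)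

lemma rootPowerSum_mul (k : ℕ) {g h : A[X]} (hg : g.Monic) (hh : h.Monic) :
    rootPowerSum k (g * h) = rootPowerSum k g + rootPowerSum k h := by
  simp [rootPowerSum, powerSumSeries_mul hg hh]

lemma rootPowerSum_one (k : ℕ) : rootPowerSum k (1 : A[X]) = 0 := by
  simp [rootPowerSum, powerSumSeries_one]

lemma rootPowerSum_pow (k n : ℕ) {g : A[X]} (hg : g.Monic) :
    rootPowerSum k (g ^ n) = n * rootPowerSum k g := by
  induction n with
  | zero => simp [rootPowerSum_one]
  | succ n ih => rw [pow_succ, rootPowerSum_mul k (hg.pow n) hg, ih]; push_cast; ring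

lemma rootPowerSum_map (k : ℕ) (φ : A →+* B) {g : A[X]} (hg : g.Monic) :
    rootPowerSum k (g.map φ) = φ (rootPowerSum k g) := by
  simp [rootPowerSum, powerSumSeries_map φ hg]

lemma rootPowerSum_prod {k : ℕ} (hk : k ≠ 0) (m : Multiset A) :
    rootPowerSum k (m.map fun a => X - C a).prod = (m.map (· ^ k)).sum := by
  induction m using Multiset.induction_on with
  | empty => simp [rootPowerSum_one]
  | cons a m ih =>
    rw [Multiset.map_cons, Multiset.prod_cons, rootPowerSum_mul k (monic_X_sub_C a)
      (monic_multiset_prod_of_monic _ _ fun a _ => monic_X_sub_C a), ih, Multiset.map_cons,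
      Multiset.sum_cons, rootPowerSum, powerSumSeries_X_sub_C]
    simp [hk]

lemma natDegree_add_C_mul_X_pow {g : A[X]} {s : ℕ} (hs : 1 ≤ s)
    (hn : s ≤ g.natDegree) (u : A) :
    (g + C u * X ^ (g.natDegree - s)).natDegree = g.natDegree := by
  apply natDegree_add_eq_left_of_natDegree_lt
  refine (natDegree_C_mul_X_pow_le _ _).trans_lt ?_
  omega

lemma monic_add_C_mul_X_pow {g : A[X]} (hg : g.Monic) {s : ℕ} (hs : 1 ≤ s)
    (hn : s ≤ g.natDegree) (u : A) : (g + C u * X ^ (g.natDegree - s)).Monic := by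
  apply hg.add_of_left
  rw [degree_eq_natDegree hg.ne_zero]
  refine (degree_C_mul_X_pow_le _ _).trans_lt ?_
  exact_mod_cast (by omega : g.natDegree - s < g.natDegree)

/-- Changing the `s`-th coefficient from the top leaves the lower power sums unchanged and
changes the `s`-th power sum linearly. -/
lemma powerSumSeries_add_C_mul_X_pow {g : A[X]} (hg : g.Monic) {s : ℕ} (hs : 1 ≤ s)
    (hn : s ≤ g.natDegree) (u : A) :
    ∃ Φ : PowerSeries A, PowerSeries.constantCoeff Φ = -(s * u) ∧
      powerSumSeries (g + C u * X ^ (g.natDegree - s)) =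
        powerSumSeries g + PowerSeries.X ^ s * Φ := by
  set h := g + C u * X ^ (g.natDegree - s) with hh
  have hm : h.Monic := monic_add_C_mul_X_pow hg hs hn u
  have hrev : (h.reverse : PowerSeries A) =
      (g.reverse : PowerSeries A) + PowerSeries.C u * PowerSeries.X ^ s := by
    have : h.reverse = g.reverse + C u * X ^ s := by
      rw [reverse, hh, natDegree_add_C_mul_X_pow hs hn, reflect_add, reflect_C_mul_X_pow,
        revAt_le (Nat.sub_le _ _), Nat.sub_sub_self hn, reverse]
    rw [this]; simp
  have hc : PowerSeries.constantCoeff (h.reverse : PowerSeries A) ≠ 0 := by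
    rw [constantCoeff_reverse hm]; exact one_ne_zero
  have hW : PowerSeries.constantCoeff (powerSumSeries g) = 0 := by
    simp [powerSumSeries]
  refine ⟨(h.reverse : PowerSeries A)⁻¹ *
    (-(PowerSeries.C (s * u)) - PowerSeries.C u * powerSumSeries g), ?_, ?_⟩
  · rw [map_mul, PowerSeries.constantCoeff_inv, constantCoeff_reverse hm]
    simp [hW]
  · symm
    apply eq_powerSumSeries hm
    have hd : PowerSeries.X * PowerSeries.derivative A (h.reverse : PowerSeries A) =
        PowerSeries.X * PowerSeries.derivative A (g.reverse : PowerSeries A) +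
          PowerSeries.C (s * u) * PowerSeries.X ^ s := by
      rw [hrev]
      obtain ⟨r, rfl⟩ : ∃ r, s = r + 1 := ⟨s - 1, by omega⟩
      simp [PowerSeries.derivative_pow, mul_add]
      ring
    rw [hd, add_mul, mul_assoc, mul_comm (h.reverse : PowerSeries A)⁻¹, mul_assoc,
      PowerSeries.inv_mul_cancel _ hc, hrev]
    linear_combination powerSumSeries_mul_reverse hg

lemma rootPowerSum_add_C_mul_X_pow {g : A[X]} (hg : g.Monic) {s : ℕ} (hs : 1 ≤ s)
    (hn : s ≤ g.natDegree) (u : A) :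
    rootPowerSum s (g + C u * X ^ (g.natDegree - s)) = rootPowerSum s g - s * u := by
  obtain ⟨Φ, h0, h⟩ := powerSumSeries_add_C_mul_X_pow hg hs hn u
  rw [rootPowerSum, h, map_add, PowerSeries.coeff_X_pow_mul', if_pos le_rfl, Nat.sub_self,
    PowerSeries.coeff_zero_eq_constantCoeff_apply, h0, rootPowerSum]
  ring

lemma rootPowerSum_add_C_mul_X_pow_of_lt {g : A[X]} (hg : g.Monic) {s k : ℕ} (hk : k < s)
    (hn : s ≤ g.natDegree) (u : A) :
    rootPowerSum k (g + C u * X ^ (g.natDegree - s)) = rootPowerSum k g := by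
  obtain ⟨Φ, h0, h⟩ := powerSumSeries_add_C_mul_X_pow hg (by omega) hn u
  rw [rootPowerSum, h, map_add, PowerSeries.coeff_X_pow_mul', if_neg (by omega), rootPowerSum,
    add_zero]

end PowerSums

section FiniteFieldRoots

open Polynomial

variable (F L : Type*) [Field F] [Fintype F] [Field L] [Algebra F L]

open Classical in
/-- The elements of `L` lying in the extension of degree `k` of the finite field `F`. -/
noncomputable def frobFixed (k : ℕ) : Finset L :=
  (X ^ Fintype.card F ^ k - X : L[X]).roots.toFinset

variable {F L}

lemma one_lt_card_pow {k : ℕ} (hk : k ≠ 0) : 1 < Fintype.card F ^ k :=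
  Nat.one_lt_pow hk Fintype.one_lt_card

lemma mem_frobFixed {k : ℕ} (hk : k ≠ 0) {α : L} :
    α ∈ frobFixed F L k ↔ α ^ Fintype.card F ^ k = α := by
  classical
  rw [frobFixed, Multiset.mem_toFinset,
    mem_roots (FiniteField.X_pow_card_sub_X_ne_zero L (one_lt_card_pow (F := F) hk))]
  simp [sub_eq_zero]

lemma pow_card_pow_injective (i : ℕ) : Function.Injective fun x : L => x ^ Fintype.card F ^ i := by
  induction i with
  | zero => intro x y h; simpa using h
  | succ i ih =>
    intro x y h
    have h' : (x ^ Fintype.card F) ^ Fintype.card F ^ i = (y ^ Fintype.card F) ^ Fintype.card F ^ i := by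
      simpa only [← pow_mul, ← pow_succ'] using h
    exact (FiniteField.frobeniusAlgHom F L).injective (ih h')

lemma card_frobFixed [IsAlgClosed L] {k : ℕ} (hk : k ≠ 0) :
    (frobFixed F L k).card = Fintype.card F ^ k := by
  obtain ⟨p, hp⟩ := CharP.exists F
  have : CharP L p := charP_of_injective_algebraMap (algebraMap F L).injective p
  have hdvd : p ∣ Fintype.card F ^ k := by
    apply dvd_pow _ hk
    rw [← CharP.cast_eq_zero_iff F p]
    exact Nat.cast_card_eq_zero F
  have hsep : Separable (X ^ Fintype.card F ^ k - X : L[X]) := galois_poly_separable p _ hdvd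
  classical
  rw [frobFixed, Multiset.toFinset_card_of_nodup (nodup_roots hsep),
    ← (IsAlgClosed.splits _).natDegree_eq_card_roots,
    FiniteField.X_pow_card_sub_X_natDegree_eq L (one_lt_card_pow hk)]

variable [Algebra.IsAlgebraic F L]

lemma mem_frobFixed_iff_dvd {k : ℕ} (hk : k ≠ 0) {α : L} :
    α ∈ frobFixed F L k ↔ (minpoly F α).natDegree ∣ k := by
  have hα : IsIntegral F α := Algebra.IsIntegral.isIntegral α
  rw [mem_frobFixed hk, (minpoly.irreducible hα).natDegree_dvd_iff_dvd_X_pow_card_pow_sub_X,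
    minpoly.dvd_iff, Nat.card_eq_fintype_card]
  simp [sub_eq_zero]

variable [IsAlgClosed L]

lemma roots_minpoly_map (α : L) :
    ((minpoly F α).map (algebraMap F L)).roots =
      (Multiset.range (minpoly F α).natDegree).map fun i => α ^ Fintype.card F ^ i := by
  have hα : IsIntegral F α := Algebra.IsIntegral.isIntegral α
  set P := minpoly F α with hP
  have hmonic : (P.map (algebraMap F L)).Monic := (minpoly.monic hα).map _
  symm
  apply Multiset.eq_of_le_of_card_le
  · rw [Multiset.le_iff_subset]
    · intro z hz
      obtain ⟨i, -, rfl⟩ := Multiset.mem_map.1 hz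
      rw [mem_roots hmonic.ne_zero, IsRoot, eval_map_algebraMap]
      have h : ∀ i, aeval (α ^ Fintype.card F ^ i) P = 0 := by
        intro i
        induction i with
        | zero => simp [hP, minpoly.aeval]
        | succ i ih =>
          have := aeval_algHom_apply (FiniteField.frobeniusAlgHom F L) (α ^ Fintype.card F ^ i) P
          rw [ih, map_zero, FiniteField.coe_frobeniusAlgHom] at this
          rwa [pow_succ, pow_mul]
      exact h i
    · apply Multiset.Nodup.map_on _ (Multiset.nodup_range _)
      have key : ∀ i j, i < j → j < P.natDegree →
          α ^ Fintype.card F ^ i ≠ α ^ Fintype.card F ^ j := by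
        intro i j hij hj h
        have h2 : α = α ^ Fintype.card F ^ (j - i) := by
          apply pow_card_pow_injective (F := F) i
          simp only [← pow_mul, ← pow_add, h, Nat.sub_add_cancel hij.le]
        have h3 := (mem_frobFixed (F := F) (by omega : j - i ≠ 0)).2 h2.symm
        rw [mem_frobFixed_iff_dvd (by omega), ← hP] at h3
        have := Nat.le_of_dvd (by omega) h3
        omega
      intro i hi j hj h
      rw [Multiset.mem_range] at hi hj
      rcases lt_trichotomy i j with hij | hij | hij
      · exact absurd h (key i j hij hj)
      · exact hij
      · exact absurd h.symm (key j i hij hi)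
  · rw [Multiset.card_map, Multiset.card_range, ← natDegree_map (algebraMap F L)]
    exact card_roots' _

lemma rootPowerSum_minpoly {k : ℕ} (hk : k ≠ 0) (α : L) :
    algebraMap F L (rootPowerSum k (minpoly F α)) =
      ∑ i ∈ range (minpoly F α).natDegree, (α ^ Fintype.card F ^ i) ^ k := by
  have hα : IsIntegral F α := Algebra.IsIntegral.isIntegral α
  have hmonic : ((minpoly F α).map (algebraMap F L)).Monic := (minpoly.monic hα).map _
  rw [← rootPowerSum_map k _ (minpoly.monic hα),
    ← prod_multiset_X_sub_C_of_monic_of_roots_card_eq hmonic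
      (IsAlgClosed.splits _).natDegree_eq_card_roots.symm, rootPowerSum_prod hk, roots_minpoly_map,
      Multiset.map_map]
  rfl

lemma rootPowerSum_minpoly_pow {k n : ℕ} (hk : k ≠ 0) (hn : n ≠ 0) {α : L}
    (hα : α ∈ frobFixed F L n) :
    algebraMap F L (rootPowerSum k (minpoly F α ^ (n / (minpoly F α).natDegree))) =
      ∑ i ∈ range n, (α ^ Fintype.card F ^ i) ^ k := by
  have hint : IsIntegral F α := Algebra.IsIntegral.isIntegral α
  have hpos : 0 < (minpoly F α).natDegree := minpoly.natDegree_pos hint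
  rw [rootPowerSum_pow _ _ (minpoly.monic hint), map_mul, rootPowerSum_minpoly hk, map_natCast]
  obtain ⟨m, rfl⟩ := (mem_frobFixed_iff_dvd hn).1 hα
  rw [Nat.mul_div_cancel_left _ hpos]
  have hfix : α ^ Fintype.card F ^ (minpoly F α).natDegree = α :=
    (mem_frobFixed hpos.ne').1 ((mem_frobFixed_iff_dvd hpos.ne').2 dvd_rfl)
  have hper : ∀ m i, α ^ Fintype.card F ^ ((minpoly F α).natDegree * m + i) =
      α ^ Fintype.card F ^ i := by
    intro m i
    induction m with
    | zero => simp
    | succ m ih =>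
      rw [mul_add, mul_one, add_right_comm, add_comm _ (minpoly F α).natDegree, pow_add, pow_mul,
        hfix, ih]
  clear hα hn
  induction m with
  | zero => simp
  | succ m ih =>
    rw [mul_add, mul_one, sum_range_add, ← ih]
    simp only [hper]
    push_cast
    ring

end FiniteFieldRoots

section MonicSums

open Polynomial

variable {F : Type*} [Field F] [Fintype F]

lemma finite_monic_natDegree_eq (F : Type*) [Field F] [Fintype F] (n : ℕ) :
    {g : F[X] | g.Monic ∧ g.natDegree = n}.Finite := by
  apply Set.Finite.of_finite_image (f := fun g : F[X] => fun i : Fin (n + 1) => g.coeff i)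
    (Set.toFinite _)
  rintro g ⟨-, hg⟩ h ⟨-, hh⟩ hgh
  ext i
  by_cases hi : i < n + 1
  · exact congrFun hgh ⟨i, hi⟩
  · rw [coeff_eq_zero_of_natDegree_lt (by omega), coeff_eq_zero_of_natDegree_lt (by omega)]

/-- The monic polynomials of degree `n` over a finite field. -/
noncomputable def monicFinset (F : Type*) [Field F] [Fintype F] (n : ℕ) : Finset F[X] :=
  (finite_monic_natDegree_eq F n).toFinset

lemma mem_monicFinset {n : ℕ} {g : F[X]} :
    g ∈ monicFinset F n ↔ g.Monic ∧ g.natDegree = n := by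
  simp [monicFinset]

lemma sum_monicFinset_zero {M : Type*} [AddCommMonoid M] (lam : F[X] → M) :
    ∑ g ∈ monicFinset F 0, lam g = lam 1 := by
  have : monicFinset F 0 = {1} := by
    ext g
    rw [mem_monicFinset, mem_singleton]
    constructor
    · rintro ⟨h, h0⟩
      exact h.natDegree_eq_zero.1 h0
    · rintro rfl
      exact ⟨monic_one, natDegree_one⟩
  rw [this, sum_singleton]

variable {L : Type*} [Field L] [Algebra F L] [Algebra.IsAlgebraic F L] [IsAlgClosed L]

lemma dvd_minpoly_pow_card {g : F[X]} (hg : g.Monic) (α : L) [DecidableEq L]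
    [DecidablePred fun j => minpoly F α ^ j ∣ g] :
    (g.map (algebraMap F L)).roots.count α =
      ((Icc 1 g.natDegree).filter fun j => minpoly F α ^ j ∣ g).card := by
  have hα : IsIntegral F α := Algebra.IsIntegral.isIntegral α
  have hirr := minpoly.irreducible hα
  have hdeg : 0 < (minpoly F α).natDegree := minpoly.natDegree_pos hα
  have hfin : FiniteMultiplicity (minpoly F α) g :=
    FiniteMultiplicity.of_not_isUnit hirr.not_isUnit hg.ne_zero
  obtain ⟨h, hh, hndvd⟩ := hfin.exists_eq_pow_mul_and_not_dvd
  set v := multiplicity (minpoly F α) g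
  have h0 : h ≠ 0 := by
    rintro rfl
    exact hg.ne_zero (by simpa using hh)
  have hP0 : minpoly F α ≠ 0 := hirr.ne_zero
  have hinj := (algebraMap F L).injective
  have hcount : (g.map (algebraMap F L)).roots.count α = v := by
    rw [hh, Polynomial.map_mul, Polynomial.map_pow, roots_mul, roots_pow, Multiset.count_add,
      Multiset.count_nsmul, Multiset.count_eq_one_of_mem, Multiset.count_eq_zero_of_notMem]
    · simp
    · rw [mem_roots (Polynomial.map_ne_zero h0), IsRoot, eval_map_algebraMap, ← minpoly.dvd_iff]
      exact hndvd
    · exact nodup_roots (((PerfectField.separable_of_irreducible hirr)).map)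
    · rw [mem_roots (Polynomial.map_ne_zero hP0), IsRoot, eval_map_algebraMap, minpoly.aeval]
    · exact mul_ne_zero (pow_ne_zero _ (Polynomial.map_ne_zero hP0)) (Polynomial.map_ne_zero h0)
  have hv : v ≤ g.natDegree := by
    rw [hh, natDegree_mul (pow_ne_zero _ hP0) h0, natDegree_pow]
    nlinarith
  have hfilter : ((Icc 1 g.natDegree).filter fun j => minpoly F α ^ j ∣ g) = Icc 1 v := by
    ext j
    simp only [mem_filter, mem_Icc, hfin.pow_dvd_iff_le_multiplicity]
    omega
  rw [hcount, hfilter]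
  simp

lemma natDegree_eq_sum_dvd {g : F[X]} (hg : g.Monic) {n : ℕ} (hn : g.natDegree = n)
    [∀ α : L, DecidablePred fun j => minpoly F α ^ j ∣ g] :
    n = ∑ α ∈ frobFixed F L n.factorial, ∑ j ∈ Icc 1 n,
      if minpoly F α ^ j ∣ g then 1 else 0 := by
  classical
  subst hn
  simp only [← sum_filter, sum_const, smul_eq_mul, mul_one]
  simp only [← dvd_minpoly_pow_card hg]
  rw [Multiset.sum_count_eq_card, ← (IsAlgClosed.splits _).natDegree_eq_card_roots, natDegree_map]
  intro α hα
  rw [mem_roots (Polynomial.map_ne_zero hg.ne_zero), IsRoot, eval_map_algebraMap,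
    ← minpoly.dvd_iff] at hα
  rw [mem_frobFixed_iff_dvd (Nat.factorial_ne_zero _)]
  exact Nat.dvd_factorial (minpoly.natDegree_pos (Algebra.IsIntegral.isIntegral α))
    (natDegree_le_of_dvd hα hg.ne_zero)

lemma sum_monicFinset_dvd {lam : F[X] → ℂ}
    (hmul : ∀ g h : F[X], g.Monic → h.Monic → lam (g * h) = lam g * lam h) {P : F[X]}
    (hP : P.Monic) (n : ℕ) [DecidablePred fun g => P ∣ g] :
    ∑ g ∈ (monicFinset F n).filter (P ∣ ·), lam g =
      if P.natDegree ≤ n then lam P * ∑ g ∈ monicFinset F (n - P.natDegree), lam g else 0 := by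
  split_ifs with h
  · rw [mul_sum]
    symm
    apply sum_bij (fun g _ => P * g)
    · intro g hg
      rw [mem_monicFinset] at hg
      rw [mem_filter, mem_monicFinset, hP.natDegree_mul hg.1]
      exact ⟨⟨hP.mul hg.1, by omega⟩, dvd_mul_right _ _⟩
    · intro g _ g' _ hgg
      exact mul_left_cancel₀ hP.ne_zero hgg
    · intro g hg
      rw [mem_filter, mem_monicFinset] at hg
      obtain ⟨⟨hg, hn⟩, h, rfl⟩ := hg
      have hh : h.Monic := hP.of_mul_monic_left hg
      rw [hP.natDegree_mul hh] at hn
      exact ⟨h, mem_monicFinset.2 ⟨hh, by omega⟩, rfl⟩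
    · intro g hg
      exact (hmul P g hP (mem_monicFinset.1 hg).1).symm
  · rw [filter_false_of_mem, sum_empty]
    intro g hg hd
    rw [mem_monicFinset] at hg
    exact h (hg.2 ▸ natDegree_le_of_dvd hd hg.1.ne_zero)

/-- Newton-type recursion linking sums of a completely multiplicative function over monic
polynomials with sums over the finite extensions of `F`. -/
lemma natCast_mul_sum_monicFinset (L : Type*) [Field L] [Algebra F L] [Algebra.IsAlgebraic F L]
    [IsAlgClosed L] {lam : F[X] → ℂ}
    (hmul : ∀ g h : F[X], g.Monic → h.Monic → lam (g * h) = lam g * lam h) (n : ℕ) :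
    n * ∑ g ∈ monicFinset F n, lam g =
      ∑ k ∈ Icc 1 n, (∑ α ∈ frobFixed F L k, lam (minpoly F α ^ (k / (minpoly F α).natDegree))) *
        ∑ g ∈ monicFinset F (n - k), lam g := by
  classical
  set A : ℕ → ℂ := fun n => ∑ g ∈ monicFinset F n, lam g with hA
  set U := frobFixed F L n.factorial
  have hpos : ∀ α : L, 0 < (minpoly F α).natDegree := fun α =>
    minpoly.natDegree_pos (Algebra.IsIntegral.isIntegral α)
  have hmon : ∀ α : L, (minpoly F α).Monic := fun α =>
    minpoly.monic (Algebra.IsIntegral.isIntegral α)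
  have hl : n * A n = ∑ α ∈ U, ∑ j ∈ Icc 1 n,
      if j * (minpoly F α).natDegree ≤ n then
        lam (minpoly F α ^ j) * A (n - j * (minpoly F α).natDegree) else 0 := by
    have h1 : n * A n = ∑ g ∈ monicFinset F n, ∑ α ∈ U, ∑ j ∈ Icc 1 n,
        if minpoly F α ^ j ∣ g then lam g else 0 := by
      rw [hA, mul_sum]
      apply sum_congr rfl
      intro g hg
      rw [mem_monicFinset] at hg
      have h2 := congrArg (Nat.cast : ℕ → ℂ) (natDegree_eq_sum_dvd (L := L) hg.1 hg.2)
      rw [h2]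
      push_cast
      rw [sum_mul]
      apply sum_congr rfl
      intro α _
      rw [sum_mul]
      simp
    rw [h1, sum_comm]
    apply sum_congr rfl
    intro α _
    rw [sum_comm]
    apply sum_congr rfl
    intro j _
    rw [← sum_filter, sum_monicFinset_dvd hmul ((hmon α).pow j), natDegree_pow]
  have hr : ∑ k ∈ Icc 1 n, (∑ α ∈ frobFixed F L k,
      lam (minpoly F α ^ (k / (minpoly F α).natDegree))) * A (n - k) =
      ∑ α ∈ U, ∑ k ∈ Icc 1 n, if (minpoly F α).natDegree ∣ k then
        lam (minpoly F α ^ (k / (minpoly F α).natDegree)) * A (n - k) else 0 := by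
    rw [sum_comm]
    apply sum_congr rfl
    intro k hk
    rw [mem_Icc] at hk
    rw [sum_mul, ← sum_filter]
    apply sum_congr _ fun _ _ => rfl
    ext α
    rw [mem_filter, mem_frobFixed_iff_dvd (by omega), mem_frobFixed_iff_dvd n.factorial_ne_zero]
    exact ⟨fun h => ⟨h.trans (Nat.dvd_factorial (by omega) hk.2), h⟩, fun h => h.2⟩
  change n * A n = ∑ k ∈ Icc 1 n, (∑ α ∈ frobFixed F L k,
    lam (minpoly F α ^ (k / (minpoly F α).natDegree))) * A (n - k)
  rw [hl, hr]
  apply sum_congr rfl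
  intro α _
  have he := hpos α
  rw [← sum_filter, ← sum_filter]
  apply sum_nbij' (fun j => j * (minpoly F α).natDegree) (fun k => k / (minpoly F α).natDegree)
  · intro j hj
    simp only [mem_filter, mem_Icc] at hj ⊢
    exact ⟨⟨Nat.mul_pos hj.1.1 he, hj.2⟩, dvd_mul_left _ _⟩
  · intro k hk
    simp only [mem_filter, mem_Icc] at hk ⊢
    rw [Nat.div_mul_cancel hk.2]
    exact ⟨⟨Nat.div_pos (Nat.le_of_dvd (by omega) hk.2) he, (Nat.div_le_self _ _).trans hk.1.2⟩,
      hk.1.2⟩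
  · intro j _
    exact Nat.mul_div_cancel _ he
  · intro k hk
    simp only [mem_filter, mem_Icc] at hk
    exact Nat.div_mul_cancel hk.2
  · intro j _
    rw [Nat.mul_div_cancel _ he]

end MonicSums

section Stepanov

open Polynomial

variable {F : Type*} [Field F] [Fintype F]

lemma aeval_pow_card_pow {L : Type*} [Field L] [Algebra F L] (f : F[X]) (α : L) (i : ℕ) :
    aeval (α ^ Fintype.card F ^ i) f = aeval α f ^ Fintype.card F ^ i := by
  induction i with
  | zero => simp
  | succ i ih =>
    have := aeval_algHom_apply (FiniteField.frobeniusAlgHom F L) (α ^ Fintype.card F ^ i) f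
    rw [ih, FiniteField.coe_frobeniusAlgHom] at this
    rw [pow_succ, pow_mul, pow_mul, this]

lemma natDegree_sum_pow_card_pow {f : F[X]} (hf : 0 < f.natDegree) (m : ℕ) :
    (∑ i ∈ range (m + 1), f ^ Fintype.card F ^ i).natDegree =
      f.natDegree * Fintype.card F ^ m := by
  induction m with
  | zero => simp
  | succ m ih =>
    rw [sum_range_succ, natDegree_add_eq_right_of_natDegree_lt, natDegree_pow, mul_comm]
    rw [ih, natDegree_pow, mul_comm]
    apply Nat.mul_lt_mul_of_pos_right _ hf
    exact Nat.pow_lt_pow_right Fintype.one_lt_card (Nat.lt_succ_self m)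

lemma eq_zero_of_sum_eq_zero_of_natDegree_injective {ι K : Type*} [Fintype ι] [Field K]
    {p : ι → K[X]} (hp : ∀ i, p i ≠ 0) (hdeg : Function.Injective fun i => (p i).natDegree)
    {c : ι → K} (h : ∑ i, c i • p i = 0) : c = 0 := by
  have h1 := degree_sum_eq_of_disjoint (fun i => c i • p i) univ (by
    rintro i ⟨-, hi⟩ j ⟨-, hj⟩ hij heq
    have hi' : c i ≠ 0 := fun h => hi (by simp [h])
    have hj' : c j ≠ 0 := fun h => hj (by simp [h])
    simp only [Function.comp, smul_eq_C_mul, degree_C_mul hi', degree_C_mul hj'] at heq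
    exact hij (hdeg (natDegree_eq_natDegree heq)))
  rw [h, degree_zero, eq_comm, Finset.sup_eq_bot_iff] at h1
  funext i
  have := h1 i (mem_univ i)
  rw [degree_eq_bot, smul_eq_zero] at this
  exact this.resolve_right (hp i)

lemma exists_ne_zero_sum_smul_eq_zero {ι K : Type*} [Fintype ι] [Field K] (p : ι → K[X]) {N : ℕ}
    (hdeg : ∀ i, (p i).natDegree < N) (hN : N < Fintype.card ι) :
    ∃ c : ι → K, c ≠ 0 ∧ ∑ i, c i • p i = 0 := by
  let Φ : (ι → K) →ₗ[K] (Fin N → K) :=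
    LinearMap.pi fun n => (lcoeff K (n : ℕ)).comp (Fintype.linearCombination K p)
  obtain ⟨c, hc, hc0⟩ := (Submodule.ne_bot_iff _).1
    (LinearMap.ker_ne_bot_of_finrank_lt (f := Φ) (by simpa using hN))
  refine ⟨c, hc0, ?_⟩
  ext n
  by_cases hn : n < N
  · have := congrFun (LinearMap.mem_ker.1 hc) ⟨n, hn⟩
    simpa [Φ, Fintype.linearCombination_apply] using this
  · rw [finsetSum_coeff, coeff_zero]
    apply sum_eq_zero
    intro i _
    rw [coeff_smul, coeff_eq_zero_of_natDegree_lt ((hdeg i).trans_le (not_lt.1 hn)), smul_zero]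

/-- Stepanov's bound for the number of points of given trace. -/
lemma card_trace_eq_le {L : Type*} [Field L] [Algebra F L] {f : F[X]} (hf : 0 < f.natDegree)
    (hco : f.natDegree.Coprime (Fintype.card F)) (t : F) (m : ℕ) [DecidableEq L] :
    ((frobFixed F L (2 * (m + 1))).filter fun α =>
      ∑ i ∈ range (2 * (m + 1)), aeval α f ^ Fintype.card F ^ i = algebraMap F L t).card ≤
      Fintype.card F ^ (2 * m + 1) + 2 * f.natDegree * Fintype.card F ^ (m + 1) := by
  classical
  set q := Fintype.card F with hq
  set s := f.natDegree with hs
  set D := q ^ m with hD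
  have hq1 : 1 < q := Fintype.one_lt_card
  have hD1 : 1 ≤ D := Nat.one_le_pow _ _ (by omega)
  have hR : q ^ (m + 1) = q * D := by rw [pow_succ, mul_comm]
  set g : F[X] := ∑ i ∈ range (m + 1), f ^ q ^ i with hg
  have hgdeg : g.natDegree = s * D := natDegree_sum_pow_card_pow hf m
  have hg0 : g ≠ 0 := by
    intro h
    rw [h, natDegree_zero] at hgdeg
    exact (Nat.mul_pos hf hD1).ne hgdeg
  let ι := Fin D × Fin (D + s) × Fin q
  have hlt : ∀ x : ι, (x.1 : ℕ) ≤ D - 1 ∧ (x.2.1 : ℕ) ≤ D + s - 1 ∧ (x.2.2 : ℕ) ≤ q - 1 :=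
    fun x => ⟨by omega, by omega, by omega⟩
  obtain ⟨D', hD'⟩ : ∃ D', D = D' + 1 := ⟨D - 1, by omega⟩
  obtain ⟨q', hq'⟩ : ∃ q', q = q' + 2 := ⟨q - 2, by omega⟩
  obtain ⟨s', hs'⟩ : ∃ s', s = s' + 1 := ⟨s - 1, by omega⟩
  obtain ⟨c, hc0, hc⟩ := exists_ne_zero_sum_smul_eq_zero
    (fun x : ι => X ^ ((x.1 : ℕ) * (q * D)) * X ^ (x.2.1 : ℕ) * (C t - g) ^ (x.2.2 : ℕ))
    (N := (D - 1) * (q * D) + (D + s) + (q - 1) * (s * D)) (by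
      intro x
      obtain ⟨h1, h2, h3⟩ := hlt x
      have hsub : (C t - g).natDegree ≤ s * D := by
        refine (natDegree_sub_le _ _).trans ?_
        simp [hgdeg]
      calc _ ≤ (x.1 : ℕ) * (q * D) + (x.2.1 : ℕ) + (x.2.2 : ℕ) * (s * D) := by
            refine natDegree_mul_le.trans (add_le_add (natDegree_mul_le.trans ?_) ?_)
            · simp
            · exact natDegree_pow_le.trans (Nat.mul_le_mul_left _ hsub)
        _ ≤ (D - 1) * (q * D) + (D + s - 1) + (q - 1) * (s * D) := by gcongr
        _ < _ := by omega)
    (by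
      simp only [ι, Fintype.card_prod, Fintype.card_fin]
      rw [hD', hq', hs']
      simp only [Nat.add_sub_cancel, show q' + 2 - 1 = q' + 1 by omega]
      nlinarith [Nat.zero_le (D' * s'), Nat.zero_le (D' * q')])
  set p : ι → F[X] := fun x => X ^ (x.1 : ℕ) * X ^ ((x.2.1 : ℕ) * (q * D)) * g ^ (x.2.2 : ℕ)
    with hp
  have hpdeg : ∀ x, (p x).natDegree = x.1 + D * (x.2.1 * q + x.2.2 * s) := by
    intro x
    rw [hp, natDegree_mul (mul_ne_zero (pow_ne_zero _ X_ne_zero) (pow_ne_zero _ X_ne_zero))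
      (pow_ne_zero _ hg0), natDegree_mul (pow_ne_zero _ X_ne_zero) (pow_ne_zero _ X_ne_zero),
      natDegree_X_pow, natDegree_X_pow, natDegree_pow, hgdeg]
    ring
  have hp0 : ∀ x, p x ≠ 0 := fun x => mul_ne_zero (mul_ne_zero (pow_ne_zero _ X_ne_zero)
    (pow_ne_zero _ X_ne_zero)) (pow_ne_zero _ hg0)
  have hinj : Function.Injective fun x => (p x).natDegree := by
    rintro ⟨l, i, j⟩ ⟨l', i', j'⟩ h
    simp only [hpdeg] at h
    have hl : (l : ℕ) = l' := by
      have := congrArg (· % D) h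
      simpa [Nat.add_mul_mod_self_left, Nat.mod_eq_of_lt] using this
    rw [hl] at h
    have h2 : (i : ℕ) * q + j * s = i' * q + j' * s := by
      exact Nat.eq_of_mul_eq_mul_left hD1 (Nat.add_left_cancel h)
    have hj : (j : ℕ) = j' := by
      have h3 : (j : ℕ) * s ≡ j' * s [MOD q] := by
        have := congrArg (· % q) h2
        simpa [Nat.ModEq, Nat.add_mod] using this
      have h4 := Nat.ModEq.cancel_right_of_coprime hco.symm h3
      exact Nat.ModEq.eq_of_lt_of_lt h4 j.2 j'.2
    rw [hj] at h2
    have hi : (i : ℕ) = i' := Nat.eq_of_mul_eq_mul_right (by omega) (Nat.add_right_cancel h2)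
    exact Prod.ext (Fin.ext hl) (Prod.ext (Fin.ext hi) (Fin.ext hj))
  set H : F[X] := ∑ x, c x • p x with hH
  have hH0 : H ≠ 0 := fun h => hc0 (eq_zero_of_sum_eq_zero_of_natDegree_injective hp0 hinj h)
  have hHdeg : H.natDegree ≤ q ^ (2 * m + 1) + 2 * s * q ^ (m + 1) := by
    have hpow : q ^ (2 * m + 1) = q * D * D := by rw [hD]; ring
    rw [hpow, hR]
    apply natDegree_sum_le_of_forall_le
    intro x _
    refine (natDegree_smul_le _ _).trans ?_
    rw [hpdeg]
    obtain ⟨h1, h2, h3⟩ := hlt x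
    calc _ ≤ (D - 1) + D * ((D + s - 1) * q + (q - 1) * s) := by gcongr
      _ ≤ _ := by
        rw [hD', hq', hs']
        simp only [Nat.add_sub_cancel, show q' + 2 - 1 = q' + 1 by omega,
          show D' + 1 + (s' + 1) - 1 = D' + s' + 1 by omega]
        nlinarith [Nat.zero_le (D' * s'), Nat.zero_le (D' * q')]
  refine le_trans ?_ hHdeg
  rw [← natDegree_map (algebraMap F L)]
  refine le_trans ?_ (card_roots' _)
  refine le_trans ?_ (Multiset.toFinset_card_le _)
  apply card_le_card_of_injOn (fun α => α ^ q ^ (m + 1)) _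
    ((pow_card_pow_injective (m + 1)).injOn)
  intro α hα
  rw [mem_coe, mem_filter, mem_frobFixed (by omega)] at hα
  obtain ⟨hfix, htr⟩ := hα
  rw [mem_coe, Multiset.mem_toFinset, mem_roots (Polynomial.map_ne_zero hH0), IsRoot,
    eval_map_algebraMap]
  have hgα : aeval (α ^ q ^ (m + 1)) g = algebraMap F L t - aeval α g := by
    have hfr : aeval (α ^ q ^ (m + 1)) f = aeval α f ^ q ^ (m + 1) := aeval_pow_card_pow f α (m + 1)
    rw [← htr, two_mul, sum_range_add, hg, map_sum, map_sum]
    simp [hfr, ← pow_mul, ← pow_add]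
  have hfix' : (α ^ (q * D)) ^ (q * D) = α := by
    rw [← hR, ← pow_mul, ← pow_add, ← two_mul]
    exact hfix
  have hval := congrArg (aeval α) hc
  rw [map_zero, map_sum] at hval
  rw [hH, map_sum, ← hval]
  apply sum_congr rfl
  intro x _
  simp only [hp, map_smul, map_mul, map_pow, aeval_X, map_sub, aeval_C, hgα]
  rw [hR, mul_comm (x.2.1 : ℕ), pow_mul _ (q * D) (x.2.1 : ℕ), hfix', mul_comm (x.1 : ℕ),
    pow_mul α (q * D) (x.1 : ℕ)]

end Stepanov

section WeilBound

open Polynomial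

lemma norm_le_of_norm_powerSum_le {m : Multiset ℂ} {K R : ℝ} (hR : 0 < R)
    (h : ∀ n : ℕ, 1 ≤ n → ‖(m.map (· ^ n)).sum‖ ≤ K * R ^ n) {z : ℂ} (hz : z ∈ m) : ‖z‖ ≤ R := by
  classical
  set Q : ℂ[X] := ∏ w ∈ m.toFinset.erase z, (X - C w) with hQ
  have hQz : Q.eval z ≠ 0 := by
    rw [hQ, eval_prod, prod_ne_zero_iff]
    intro w hw
    simpa [sub_eq_zero] using (ne_of_mem_erase hw).symm
  have hQw : ∀ w ∈ m, w ≠ z → Q.eval w = 0 := by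
    intro w hw hwz
    rw [hQ, eval_prod]
    exact prod_eq_zero (mem_erase.2 ⟨hwz, Multiset.mem_toFinset.2 hw⟩) (by simp)
  have hleft : ∀ n, (m.map fun w => w ^ n * Q.eval w).sum = m.count z * (z ^ n * Q.eval z) := by
    intro n
    rw [Finset.sum_multiset_map_count, sum_eq_single z]
    · rw [nsmul_eq_mul]
    · intro w hw hwz
      rw [hQw w (Multiset.mem_toFinset.1 hw) hwz]
      simp
    · intro h
      exact absurd (Multiset.mem_toFinset.2 hz) h
  have hright : ∀ n, (m.map fun w => w ^ n * Q.eval w).sum =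
      ∑ i ∈ range (Q.natDegree + 1), Q.coeff i * (m.map (· ^ (n + i))).sum := by
    intro n
    simp only [← Multiset.sum_map_mul_left]
    rw [← Multiset.sum_map_sum]
    congr 1
    apply Multiset.map_congr rfl
    intro w _
    rw [eval_eq_sum_range, mul_sum]
    apply sum_congr rfl
    intro i _
    ring
  have hcount : (1 : ℝ) ≤ m.count z := by exact_mod_cast Multiset.one_le_count_iff_mem.2 hz
  set B : ℝ := ∑ i ∈ range (Q.natDegree + 1), ‖Q.coeff i‖ * (K * R ^ i)
  have hbound : ∀ n : ℕ, 1 ≤ n → ‖z‖ ^ n * ‖Q.eval z‖ ≤ B * R ^ n := by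
    intro n hn
    calc ‖z‖ ^ n * ‖Q.eval z‖ ≤ m.count z * (‖z‖ ^ n * ‖Q.eval z‖) :=
          le_mul_of_one_le_left (by positivity) hcount
      _ = ‖(m.map fun w => w ^ n * Q.eval w).sum‖ := by rw [hleft]; simp
      _ ≤ ∑ i ∈ range (Q.natDegree + 1), ‖Q.coeff i‖ * (K * R ^ (n + i)) := by
          rw [hright]
          refine (norm_sum_le _ _).trans (sum_le_sum fun i _ => ?_)
          rw [norm_mul]
          exact mul_le_mul_of_nonneg_left (h _ (by omega)) (norm_nonneg _)
      _ = B * R ^ n := by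
          rw [sum_mul]
          apply sum_congr rfl
          intro i _
          ring
  by_contra! hlt
  have hgt : 1 < ‖z‖ / R := (one_lt_div hR).2 hlt
  have hpos : 0 < ‖Q.eval z‖ := norm_pos_iff.2 hQz
  obtain ⟨n, hn⟩ := pow_unbounded_of_one_lt (B / ‖Q.eval z‖) hgt
  have hn1 : B / ‖Q.eval z‖ < (‖z‖ / R) ^ (n + 1) :=
    hn.trans_le (pow_le_pow_right₀ hgt.le (Nat.le_succ n))
  rw [div_lt_iff₀ hpos, div_pow, div_mul_eq_mul_div, lt_div_iff₀ (by positivity)] at hn1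
  exact absurd (hbound (n + 1) (by omega)) (not_le.2 hn1)

/-- A sequence with a polynomial generating function of degree `< s` has logarithmic derivative
given by minus the power sums of `s - 1` complex numbers. -/
lemma exists_multiset_powerSum {A S : ℕ → ℂ} {s : ℕ} (hs : 1 ≤ s) (hA0 : A 0 = 1)
    (hA : ∀ n, s ≤ n → A n = 0)
    (hrec : ∀ n : ℕ, n * A n = ∑ k ∈ Icc 1 n, S k * A (n - k)) :
    ∃ m : Multiset ℂ, m.card = s - 1 ∧ ∀ k : ℕ, k ≠ 0 → S k = -(m.map (· ^ k)).sum := by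
  set P : ℂ[X] := ∑ i ∈ range s, C (A i) * X ^ i with hP
  have hPcoeff : ∀ n, P.coeff n = A n := by
    intro n
    rw [hP, finsetSum_coeff]
    simp only [coeff_C_mul_X_pow]
    rw [sum_ite_eq]
    split_ifs with h
    · rfl
    · exact (hA n (by simpa using h)).symm
  have hPdeg : P.natDegree ≤ s - 1 := by
    rw [natDegree_le_iff_coeff_eq_zero]
    intro n hn
    rw [hPcoeff, hA n (by omega)]
  set Z := P.reflect (s - 1) with hZ
  have hZdeg : Z.natDegree ≤ s - 1 := natDegree_reflect_le.trans (max_le le_rfl hPdeg)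
  have hZcoeff : Z.coeff (s - 1) = 1 := by
    rw [hZ, coeff_reflect, revAt_le le_rfl, Nat.sub_self, hPcoeff, hA0]
  have hZmonic : Z.Monic := monic_of_natDegree_le_of_coeff_eq_one _ hZdeg hZcoeff
  have hZnat : Z.natDegree = s - 1 :=
    natDegree_eq_of_le_of_coeff_ne_zero hZdeg (by rw [hZcoeff]; exact one_ne_zero)
  have hrev : Z.reverse = P := by
    rw [reverse, hZnat, hZ, reflect_reflect]
  have hcard : Z.roots.card = Z.natDegree := (IsAlgClosed.splits Z).natDegree_eq_card_roots.symm
  refine ⟨Z.roots, hcard.trans hZnat, fun k hk => ?_⟩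
  have hseries : -PowerSeries.mk (fun k => if k = 0 then 0 else S k) = powerSumSeries Z := by
    apply eq_powerSumSeries hZmonic
    rw [hrev, neg_mul, neg_inj]
    ext n
    have hd : PowerSeries.coeff n (PowerSeries.X * PowerSeries.derivative ℂ (P : PowerSeries ℂ)) =
        n * A n := by
      rcases n with _ | n
      · simp
      · rw [PowerSeries.coeff_succ_X_mul, PowerSeries.coeff_derivative, coeff_coe, hPcoeff]
        push_cast
        ring
    rw [hd, hrec, PowerSeries.coeff_mul, Nat.sum_antidiagonal_eq_sum_range_succ_mk]
    simp only [PowerSeries.coeff_mk, coeff_coe, hPcoeff]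
    rw [sum_range_succ', range_eq_Ico, sum_Ico_add' (fun k =>
      (if k = 0 then 0 else S k) * A (n - k)) 0 n 1]
    simp only [if_true, zero_mul, add_zero]
    apply sum_congr
    · ext k
      simp
    · intro k hk
      rw [if_neg (by have := (mem_Icc.1 hk).1; omega)]
  rw [← rootPowerSum_prod hk, prod_multiset_X_sub_C_of_monic_of_roots_card_eq hZmonic hcard,
    rootPowerSum, ← hseries]
  simp [hk]

variable {F : Type*} [Field F] [Fintype F]

/-- The additive function on monic polynomials attached to `a x ^ s + b x`. -/
noncomputable def binomialTrace (a b : F) (s : ℕ) (g : F[X]) : F :=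
  a * rootPowerSum s g + b * rootPowerSum 1 g

lemma binomialTrace_mul (a b : F) (s : ℕ) {g h : F[X]} (hg : g.Monic) (hh : h.Monic) :
    binomialTrace a b s (g * h) = binomialTrace a b s g + binomialTrace a b s h := by
  simp only [binomialTrace, rootPowerSum_mul _ hg hh]
  ring

lemma sum_monicFinset_eq_zero {ψ : AddChar F ℂ} (hψ : ψ ≠ 1) {a : F} (ha : a ≠ 0) (b : F) {s : ℕ}
    (hs : 2 ≤ s) (hsF : (s : F) ≠ 0) {n : ℕ} (hn : s ≤ n) :
    ∑ g ∈ monicFinset F n, ψ (binomialTrace a b s g) = 0 := by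
  obtain ⟨v, hv⟩ := AddChar.ne_one_iff.1 hψ
  set u : F := -v / (a * s) with hu
  have hshift : ∀ w : F, ∀ g ∈ monicFinset F n, g + C w * X ^ (n - s) ∈ monicFinset F n := by
    intro w g hg
    obtain ⟨hmon, rfl⟩ := mem_monicFinset.1 hg
    exact mem_monicFinset.2 ⟨monic_add_C_mul_X_pow hmon (by omega) hn w,
      natDegree_add_C_mul_X_pow (by omega) hn w⟩
  have h : ∑ g ∈ monicFinset F n, ψ (binomialTrace a b s g) =
      ψ v * ∑ g ∈ monicFinset F n, ψ (binomialTrace a b s g) := by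
    rw [mul_sum]
    symm
    apply sum_nbij' (fun g => g + C u * X ^ (n - s)) (fun g => g + C (-u) * X ^ (n - s))
    · exact hshift u
    · exact hshift (-u)
    · intro g _
      simp
    · intro g _
      simp
    · intro g hg
      obtain ⟨hmon, rfl⟩ := mem_monicFinset.1 hg
      rw [← AddChar.map_add_eq_mul, binomialTrace, binomialTrace,
        rootPowerSum_add_C_mul_X_pow hmon (by omega) hn,
        rootPowerSum_add_C_mul_X_pow_of_lt hmon (by omega) hn, hu]
      congr 1
      field_simp
      ring
  have h2 : (1 - ψ v) * ∑ g ∈ monicFinset F n, ψ (binomialTrace a b s g) = 0 := by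
    rw [sub_mul, one_mul, ← h, sub_self]
  exact (mul_eq_zero.1 h2).resolve_left (sub_ne_zero.2 (Ne.symm hv))

lemma norm_sum_addChar_le {ι : Type*} (V : Finset ι) (τ : ι → F) {ψ : AddChar F ℂ} (hψ : ψ ≠ 1)
    [DecidableEq F] {B : ℝ} (hB : ∀ t, ((V.filter fun x => τ x = t).card : ℝ) ≤ B) :
    ‖∑ x ∈ V, ψ (τ x)‖ ≤ Fintype.card F * B - V.card := by
  have hψn : ∀ t, ‖ψ t‖ = 1 := fun t => AddChar.norm_apply ψ t
  have h1 : ∑ x ∈ V, ψ (τ x) = ∑ t, ((V.filter fun x => τ x = t).card : ℂ) * ψ t := by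
    rw [← sum_fiberwise V τ]
    apply sum_congr rfl
    intro t _
    rw [← nsmul_eq_mul, ← sum_const]
    apply sum_congr rfl
    intro x hx
    rw [(mem_filter.1 hx).2]
  have h2 : ∑ x ∈ V, ψ (τ x) =
      -∑ t, ((B - ((V.filter fun x => τ x = t).card : ℝ) : ℝ) : ℂ) * ψ t := by
    rw [h1]
    push_cast
    simp only [sub_mul, sum_sub_distrib, ← mul_sum]
    rw [AddChar.sum_eq_zero_of_ne_one hψ]
    ring
  have h3 : (V.card : ℝ) = ∑ t, ((V.filter fun x => τ x = t).card : ℝ) := by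
    exact_mod_cast card_eq_sum_card_fiberwise (f := τ) (s := V) (t := univ) (by simp)
  rw [h2, norm_neg]
  refine (norm_sum_le _ _).trans ?_
  simp only [norm_mul, hψn, mul_one, Complex.norm_real, Real.norm_eq_abs]
  rw [h3]
  have : ∀ t, |B - ((V.filter fun x => τ x = t).card : ℝ)| =
      B - ((V.filter fun x => τ x = t).card : ℝ) := fun t => abs_of_nonneg (by linarith [hB t])
  simp only [this, sum_sub_distrib, sum_const, card_univ, nsmul_eq_mul]
  exact le_rfl

/-- Weil's bound for the sums `∑ ψ(a x ^ s + b x)`. -/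
theorem norm_sum_addChar_binomial_le {ψ : AddChar F ℂ} (hψ : ψ ≠ 1) {a : F} (ha : a ≠ 0) (b : F)
    {s : ℕ} (hs : 2 ≤ s) (hsF : (s : F) ≠ 0) :
    ‖∑ x : F, ψ (a * x ^ s + b * x)‖ ≤ (s - 1) * √(Fintype.card F) := by
  classical
  let L := AlgebraicClosure F
  set q := Fintype.card F with hq
  have hq0 : (0 : ℝ) < q := by exact_mod_cast Fintype.card_pos
  set lam : F[X] → ℂ := fun g => ψ (binomialTrace a b s g) with hlam
  set A : ℕ → ℂ := fun n => ∑ g ∈ monicFinset F n, lam g with hA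
  set S : ℕ → ℂ := fun k =>
    ∑ α ∈ frobFixed F L k, lam (minpoly F α ^ (k / (minpoly F α).natDegree)) with hS
  have hmul : ∀ g h : F[X], g.Monic → h.Monic → lam (g * h) = lam g * lam h := by
    intro g h hg hh
    simp only [hlam, binomialTrace_mul a b s hg hh, AddChar.map_add_eq_mul]
  obtain ⟨m, hmcard, hm⟩ := exists_multiset_powerSum (A := A) (S := S) (s := s) (by omega)
    (by simp [hA, sum_monicFinset_zero, hlam, binomialTrace, rootPowerSum_one])
    (fun n hn => sum_monicFinset_eq_zero hψ ha b hs hsF hn)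
    (natCast_mul_sum_monicFinset L hmul)
  set f : F[X] := C a * X ^ s + C b * X with hf
  have hfdeg : f.natDegree = s := by
    rw [hf, natDegree_add_eq_left_of_natDegree_lt, natDegree_C_mul_X_pow _ _ ha]
    rw [natDegree_C_mul_X_pow _ _ ha]
    exact (natDegree_C_mul_le _ _).trans_lt (by rw [natDegree_X]; omega)
  have htrace : ∀ k, k ≠ 0 → ∀ α ∈ frobFixed F L k,
      algebraMap F L (binomialTrace a b s (minpoly F α ^ (k / (minpoly F α).natDegree))) =
        ∑ i ∈ range k, aeval α f ^ q ^ i := by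
    intro k hk α hα
    rw [binomialTrace, map_add, map_mul, map_mul, rootPowerSum_minpoly_pow (by omega) hk hα,
      rootPowerSum_minpoly_pow one_ne_zero hk hα, mul_sum, mul_sum, ← sum_add_distrib]
    apply sum_congr rfl
    intro i _
    rw [← aeval_pow_card_pow]
    simp [hf]
  have hco : s.Coprime q := by
    obtain ⟨p, _, n, hp, hpq⟩ := FiniteField.card' F
    rw [hq, hpq]
    apply Nat.Coprime.pow_right
    rw [Nat.coprime_comm, Nat.Prime.coprime_iff_not_dvd hp]
    exact fun hdvd => hsF ((CharP.cast_eq_zero_iff F p s).2 hdvd)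
  have hSbound : ∀ n : ℕ, 1 ≤ n → ‖S (2 * n)‖ ≤ 2 * s * q * (q : ℝ) ^ n := by
    intro n hn
    obtain ⟨n, rfl⟩ : ∃ n', n = n' + 1 := ⟨n - 1, by omega⟩
    refine (norm_sum_addChar_le _ _ hψ (B := (q ^ (2 * n + 1) + 2 * s * q ^ (n + 1) : ℕ)) ?_).trans ?_
    · intro t
      rw [Nat.cast_le]
      refine le_trans (le_of_eq ?_) ((card_trace_eq_le (L := L) (f := f) (by omega)
        (by rwa [hfdeg]) t n).trans_eq (by rw [hfdeg]))
      congr 1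
      apply filter_congr
      intro α hα
      rw [← htrace _ (by omega) α hα, (algebraMap F L).injective.eq_iff]
    · rw [card_frobFixed (by omega)]
      push_cast
      apply le_of_eq
      ring
  have hnorm : ∀ z ∈ m, ‖z‖ ≤ √q := by
    intro z hz
    have h2 : ‖z ^ 2‖ ≤ q := by
      apply norm_le_of_norm_powerSum_le (m := m.map (· ^ 2)) (K := 2 * s * q) hq0 _
        (Multiset.mem_map_of_mem _ hz)
      intro n hn
      have := hSbound n hn
      rw [hm _ (by omega), norm_neg] at this
      rw [Multiset.map_map]
      simpa only [Function.comp_def, ← pow_mul] using this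
    rw [norm_pow] at h2
    exact Real.le_sqrt_of_sq_le h2
  have hS1 : ∑ x : F, ψ (a * x ^ s + b * x) = S 1 := by
    apply sum_bij (fun x _ => algebraMap F L x)
    · intro x _
      rw [mem_frobFixed one_ne_zero, pow_one, ← map_pow, FiniteField.pow_card]
    · intro x _ y _ h
      exact (algebraMap F L).injective h
    · have himg : univ.image (algebraMap F L) = frobFixed F L 1 := by
        apply eq_of_subset_of_card_le
        · intro y hy
          obtain ⟨x, -, rfl⟩ := mem_image.1 hy
          rw [mem_frobFixed one_ne_zero, pow_one, ← map_pow, FiniteField.pow_card]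
        · rw [card_frobFixed one_ne_zero, card_image_of_injective _ (algebraMap F L).injective,
            pow_one, card_univ]
      intro y hy
      rw [← himg] at hy
      obtain ⟨x, hx, rfl⟩ := mem_image.1 hy
      exact ⟨x, hx, rfl⟩
    · intro x _
      have hx : algebraMap F L x ∈ frobFixed F L 1 := by
        rw [mem_frobFixed one_ne_zero, pow_one, ← map_pow, FiniteField.pow_card]
      have h := htrace 1 one_ne_zero _ hx
      rw [hlam]
      congr 1
      apply (algebraMap F L).injective
      rw [h]
      simp [hf]
  rw [hS1, hm 1 one_ne_zero, norm_neg]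
  simp only [pow_one, Multiset.map_id']
  refine (norm_multiset_sum_le _).trans ?_
  refine (Multiset.sum_le_card_nsmul _ (√q) ?_).trans ?_
  · intro y hy
    obtain ⟨z, hz, rfl⟩ := Multiset.mem_map.1 hy
    exact hnorm z hz
  · rw [Multiset.card_map, hmcard, nsmul_eq_mul, Nat.cast_sub (by omega), Nat.cast_one]

end WeilBound

namespace SecondMoment

open scoped ComplexConjugate

variable {F : Type} [Field F] [Fintype F] {d : ℕ}

lemma addChar_map_sum {ι A M : Type*} [AddCommMonoid A] [CommMonoid M] (ψ : AddChar A M)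
    (s : Finset ι) (f : ι → A) : ψ (∑ i ∈ s, f i) = ∏ i ∈ s, ψ (f i) := by
  classical
  induction s using Finset.induction_on with
  | empty => simp
  | insert i s hi ih => rw [sum_insert hi, prod_insert hi, AddChar.map_add_eq_mul, ih]

/-- The exponential sum of the set `E` at the frequency `ξ`. -/
noncomputable def expSum (χ : AddChar F ℂ) (E : Finset (Fin d → F)) (ξ : Fin d → F) : ℂ :=
  ∑ x ∈ E, χ (ξ ⬝ᵥ x)

lemma sum_addChar_dotProduct [DecidableEq F] {χ : AddChar F ℂ} (hχ : χ.IsPrimitive)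
    (u : Fin d → F) :
    ∑ ξ : Fin d → F, χ (ξ ⬝ᵥ u) = if u = 0 then (Fintype.card F : ℂ) ^ d else 0 := by
  have h : ∑ ξ : Fin d → F, χ (ξ ⬝ᵥ u) = ∏ j, ∑ y : F, χ (y * u j) := by
    rw [prod_univ_sum, Fintype.piFinset_univ]
    simp only [dotProduct, addChar_map_sum]
  rw [h]
  simp only [AddChar.sum_mulShift _ hχ]
  split_ifs with hu
  · simp [hu]
  · obtain ⟨j, hj⟩ := Function.ne_iff.1 hu
    exact prod_eq_zero (mem_univ j) (by simpa using hj)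

lemma sum_piFinset_addChar (χ : AddChar F ℂ) (E : Finset (Fin d → F)) (k : ℕ) (ξ : Fin d → F) :
    ∑ x ∈ Fintype.piFinset fun _ : Fin k => E, χ (ξ ⬝ᵥ ∑ i, x i) = expSum χ E ξ ^ k := by
  have h := prod_univ_sum (fun _ : Fin k => E) (fun _ y => χ (ξ ⬝ᵥ y))
  rw [prod_const, card_univ, Fintype.card_fin] at h
  rw [expSum, h]
  simp only [dotProduct_sum, addChar_map_sum]

lemma card_pow_mul_energy {χ : AddChar F ℂ} (hχ : χ.IsPrimitive) (E : Finset (Fin d → F))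
    {k : ℕ} (hk : Even k) :
    (Fintype.card F : ℝ) ^ d * energy E k = ∑ ξ, ‖expSum χ E ξ‖ ^ k := by
  classical
  obtain ⟨m, rfl⟩ := hk
  set T : Finset (Fin (m + m)) := univ.filter fun i => (i : ℕ) < (m + m) / 2 with hT
  set T' : Finset (Fin (m + m)) := univ.filter fun i => ¬ (i : ℕ) < (m + m) / 2 with hT'
  have hTcard : T.card = m := by
    rw [hT, Fin.card_filter_val_lt]
    omega
  have hT'card : T'.card = m := by
    have := card_filter_add_card_filter_not (s := univ)
      (fun i : Fin (m + m) => (i : ℕ) < (m + m) / 2)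
    rw [← hT, ← hT', hTcard, card_univ, Fintype.card_fin] at this
    omega
  have henergy : (energy E (m + m) : ℂ) =
      ∑ x ∈ Fintype.piFinset fun _ : Fin (m + m) => E,
        if (∑ i ∈ T, x i) - ∑ i ∈ T', x i = 0 then 1 else 0 := by
    rw [sum_boole, energy, Nat.card_eq_fintype_card, Fintype.card_subtype]
    congr 2
    ext x
    simp only [mem_filter, mem_univ, true_and, Fintype.mem_piFinset, sub_eq_zero, hT, hT']
  have hconj : ∀ y, χ (-y) = conj (χ y) := fun y => AddChar.map_neg_eq_conj χ y
  have hfactor : ∀ ξ, ∑ x ∈ Fintype.piFinset (fun _ : Fin (m + m) => E),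
      χ (ξ ⬝ᵥ ((∑ i ∈ T, x i) - ∑ i ∈ T', x i)) = ((‖expSum χ E ξ‖ ^ (m + m) : ℝ) : ℂ) := by
    intro ξ
    have h := prod_univ_sum (fun _ : Fin (m + m) => E)
      (fun i y => if (i : ℕ) < (m + m) / 2 then χ (ξ ⬝ᵥ y) else χ (-(ξ ⬝ᵥ y)))
    have h2 : ∀ x : Fin (m + m) → Fin d → F, χ (ξ ⬝ᵥ ((∑ i ∈ T, x i) - ∑ i ∈ T', x i)) =
        ∏ i : Fin (m + m), if (i : ℕ) < (m + m) / 2 then χ (ξ ⬝ᵥ x i) else χ (-(ξ ⬝ᵥ x i)) := by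
      intro x
      rw [prod_ite, dotProduct_sub, sub_eq_add_neg, AddChar.map_add_eq_mul, dotProduct_sum,
        dotProduct_sum, ← sum_neg_distrib, addChar_map_sum, addChar_map_sum]
    simp only [h2]
    rw [← h]
    have h3 : ∀ i : Fin (m + m),
        (∑ y ∈ E, if (i : ℕ) < (m + m) / 2 then χ (ξ ⬝ᵥ y) else χ (-(ξ ⬝ᵥ y))) =
          if (i : ℕ) < (m + m) / 2 then expSum χ E ξ else conj (expSum χ E ξ) := by
      intro i
      split_ifs
      · rfl
      · simp only [expSum, map_sum, hconj]
    simp only [h3]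
    rw [prod_ite, prod_const, prod_const, ← hT, ← hT', hTcard, hT'card, ← mul_pow,
      Complex.mul_conj, Complex.normSq_eq_norm_sq, ← two_mul, pow_mul]
    push_cast
    rfl
  have hmain : ((Fintype.card F : ℝ) ^ d * energy E (m + m) : ℂ) =
      ((∑ ξ, ‖expSum χ E ξ‖ ^ (m + m) : ℝ) : ℂ) := by
    rw [Complex.ofReal_sum]
    simp only [← hfactor]
    rw [sum_comm, henergy, mul_sum]
    apply sum_congr rfl
    intro x _
    rw [sum_addChar_dotProduct hχ]
    split_ifs <;> simp
  exact_mod_cast hmain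

lemma card_pow_mul_sum_piFinset {χ : AddChar F ℂ} (hχ : χ.IsPrimitive) (E : Finset (Fin d → F))
    (k : ℕ) (g : (Fin d → F) → ℂ) :
    (Fintype.card F : ℂ) ^ d * ∑ x ∈ Fintype.piFinset (fun _ : Fin k => E), g (∑ i, x i) =
      ∑ ξ, (∑ z, g z * χ (-(ξ ⬝ᵥ z))) * expSum χ E ξ ^ k := by
  classical
  simp only [← sum_piFinset_addChar, mul_sum]
  rw [sum_comm]
  apply sum_congr rfl
  intro x _
  simp only [sum_mul]
  rw [sum_comm]
  have h : ∀ z, ∑ ξ, g z * χ (-(ξ ⬝ᵥ z)) * χ (ξ ⬝ᵥ ∑ i, x i) =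
      if z = ∑ i, x i then (Fintype.card F : ℂ) ^ d * g z else 0 := by
    intro z
    have h2 := sum_addChar_dotProduct hχ ((∑ i, x i) - z)
    simp only [dotProduct_sub, sub_eq_zero, eq_comm (a := ∑ i, x i)] at h2
    simp only [mul_assoc, ← AddChar.map_add_eq_mul, ← mul_sum, neg_add_eq_sub]
    rw [h2]
    split_ifs <;> ring
  simp [h]

lemma norm_sq_sum_piFinset_le {χ : AddChar F ℂ} (hχ : χ.IsPrimitive) (E : Finset (Fin d → F))
    {k : ℕ} (hk : Odd k) (g : (Fin d → F) → ℂ) {M : ℝ}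
    (hM : ∀ ξ, ‖∑ z, g z * χ (-(ξ ⬝ᵥ z))‖ ≤ M) :
    ‖∑ x ∈ Fintype.piFinset (fun _ : Fin k => E), g (∑ i, x i)‖ ^ 2 ≤
      M ^ 2 * (energy E (k - 1) * energy E (k + 1)) := by
  have hM0 : 0 ≤ M := (norm_nonneg _).trans (hM 0)
  obtain ⟨m, rfl⟩ := hk
  have hq : (0 : ℝ) < (Fintype.card F : ℝ) ^ d := by
    have : 0 < Fintype.card F := Fintype.card_pos
    positivity
  have h1 : (Fintype.card F : ℝ) ^ d *
      ‖∑ x ∈ Fintype.piFinset (fun _ : Fin (2 * m + 1) => E), g (∑ i, x i)‖ ≤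
        M * ∑ ξ, ‖expSum χ E ξ‖ ^ (2 * m + 1) := by
    have h := congrArg norm (card_pow_mul_sum_piFinset hχ E (2 * m + 1) g)
    rw [norm_mul, norm_pow, Complex.norm_natCast] at h
    rw [h, mul_sum]
    refine (norm_sum_le _ _).trans (sum_le_sum fun ξ _ => ?_)
    rw [norm_mul, norm_pow]
    gcongr
    exact hM ξ
  have h2 : (∑ ξ, ‖expSum χ E ξ‖ ^ (2 * m + 1)) ^ 2 ≤
      (Fintype.card F : ℝ) ^ d * energy E (2 * m) *
        ((Fintype.card F : ℝ) ^ d * energy E (2 * m + 2)) := by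
    rw [card_pow_mul_energy hχ E (even_two_mul m),
      card_pow_mul_energy hχ E (k := 2 * m + 2) ⟨m + 1, by ring⟩]
    have h := sum_mul_sq_le_sq_mul_sq univ (fun ξ => ‖expSum χ E ξ‖ ^ m)
      (fun ξ => ‖expSum χ E ξ‖ ^ (m + 1))
    simpa only [← pow_add, ← pow_mul, show m + (m + 1) = 2 * m + 1 by ring,
      show m * 2 = 2 * m by ring, show (m + 1) * 2 = 2 * m + 2 by ring] using h
  have h3 := pow_le_pow_left₀ (by positivity) h1 2
  rw [mul_pow, mul_pow] at h3
  have h4 := h3.trans (mul_le_mul_of_nonneg_left h2 (sq_nonneg M))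
  rw [Nat.add_sub_cancel]
  refine le_of_mul_le_mul_left (h4.trans_eq ?_) (pow_pos hq 2)
  ring

lemma card_mul_sum_norm_sq {χ : AddChar F ℂ} (hχ : χ.IsPrimitive) (f : F → ℂ) :
    (Fintype.card F : ℝ) * ∑ t, ‖f t‖ ^ 2 = ∑ r, ‖∑ t, f t * χ (r * t)‖ ^ 2 := by
  classical
  have h : ((Fintype.card F : ℝ) * ∑ t, ‖f t‖ ^ 2 : ℂ) =
      ((∑ r, ‖∑ t, f t * χ (r * t)‖ ^ 2 : ℝ) : ℂ) := by
    push_cast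
    simp only [← Complex.mul_conj', map_sum, map_mul, ← AddChar.map_neg_eq_conj, sum_mul_sum]
    rw [sum_comm, mul_sum]
    apply sum_congr rfl
    intro t _
    rw [sum_comm]
    have h2 : ∀ u, ∑ r, f t * χ (r * t) * (conj (f u) * χ (-(r * u))) =
        if u = t then (Fintype.card F : ℂ) * (f t * conj (f u)) else 0 := by
      intro u
      have h3 := AddChar.sum_mulShift (t - u) hχ
      simp only [sub_eq_zero, eq_comm (a := t)] at h3
      calc ∑ r, f t * χ (r * t) * (conj (f u) * χ (-(r * u)))
          = f t * conj (f u) * ∑ r, χ (r * t) * χ (-(r * u)) := by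
            rw [mul_sum]
            exact sum_congr rfl fun r _ => by ring
        _ = _ := by
            simp only [← AddChar.map_add_eq_mul, ← sub_eq_add_neg, ← mul_sub]
            rw [h3]
            split_ifs <;> simp [mul_comm]
    simp [h2]
  exact_mod_cast h

lemma sum_nuP_mul_addChar (χ : AddChar F ℂ) (a : Fin d → F) (s : ℕ) (E : Finset (Fin d → F))
    (X : Finset F) (k : ℕ) (r : F) :
    ∑ t, (nuP a s E X k t : ℂ) * χ (r * t) =
      (∑ b ∈ X, χ (r * b)) * ∑ x ∈ Fintype.piFinset (fun _ : Fin k => E),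
        χ (r * ∑ j, a j * (∑ i, x i) j ^ s) := by
  classical
  have hnu : ∀ t, (nuP a s E X k t : ℂ) =
      ∑ p ∈ X ×ˢ Fintype.piFinset (fun _ : Fin k => E),
        if p.1 + ∑ j, a j * (∑ i, p.2 i) j ^ s = t then 1 else 0 := by
    intro t
    rw [sum_boole, nuP, Nat.card_eq_fintype_card, Fintype.card_subtype]
    congr 2
    ext p
    simp only [mem_filter, mem_univ, true_and, Fintype.mem_piFinset, mem_product, and_assoc]
  rw [sum_mul_sum, ← sum_product']
  simp only [hnu, sum_mul]
  rw [sum_comm]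
  apply sum_congr rfl
  intro p _
  simp [mul_add, AddChar.map_add_eq_mul]

lemma norm_sum_addChar_diagonal_le {χ : AddChar F ℂ} (hχ : χ ≠ 1) {a : Fin d → F}
    (ha : ∀ j, a j ≠ 0) {s : ℕ} (hs : 2 ≤ s) (hsF : (s : F) ≠ 0) {r : F} (hr : r ≠ 0)
    (ξ : Fin d → F) :
    ‖∑ z : Fin d → F, χ (r * ∑ j, a j * z j ^ s) * χ (-(ξ ⬝ᵥ z))‖ ≤
      ((s - 1) * √(Fintype.card F)) ^ d := by
  have h : ∑ z : Fin d → F, χ (r * ∑ j, a j * z j ^ s) * χ (-(ξ ⬝ᵥ z)) =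
      ∏ j, ∑ y : F, χ (r * a j * y ^ s + -ξ j * y) := by
    rw [prod_univ_sum, Fintype.piFinset_univ]
    apply sum_congr rfl
    intro z _
    rw [← AddChar.map_add_eq_mul, ← addChar_map_sum, sum_add_distrib, dotProduct,
      mul_sum, ← sum_neg_distrib]
    simp only [mul_assoc, neg_mul]
  rw [h, norm_prod]
  refine (prod_le_prod (fun _ _ => norm_nonneg _) fun j _ =>
    norm_sum_addChar_binomial_le hχ (mul_ne_zero hr (ha j)) (-ξ j) hs hsF).trans_eq ?_
  simp

end SecondMoment

open SecondMoment

/-- Second-moment estimate for `ν_{P,k}` (odd `k`). -/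
theorem stmt15 (d s : ℕ) (hd : 1 ≤ d) (hs : 2 ≤ s) :
    ∃ C : ℝ, 0 < C ∧
      ∀ (F : Type) [Field F] [Fintype F],
        Odd (Fintype.card F) → ¬ (ringChar F ∣ s) →
        ∀ a : Fin d → F, (∀ j, a j ≠ 0) →
        ∀ E : Finset (Fin d → F), ∀ X : Finset F, ∀ k : ℕ, 3 ≤ k → Odd k →
        ∑ t : F, (nuP a s E X k t : ℝ) ^ 2 ≤
          (X.card : ℝ) ^ 2 * (E.card : ℝ) ^ (2 * k) / (Fintype.card F : ℝ) +
            C * (Fintype.card F : ℝ) ^ d * (X.card : ℝ) *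
              ((energy E (k - 1) : ℝ) * (energy E (k + 1) : ℝ)) := by
  have hs1 : (0 : ℝ) < s - 1 := by
    have : (2 : ℝ) ≤ s := by exact_mod_cast hs
    linarith
  refine ⟨((s - 1 : ℝ) ^ 2) ^ d, by positivity, ?_⟩
  intro F _ _ _ hchar a ha E X k _ hk
  classical
  have hsF : (s : F) ≠ 0 := fun h => hchar ((ringChar.spec F s).1 h)
  set q : ℝ := (Fintype.card F : ℝ) with hq
  have hq0 : 0 < q := by
    rw [hq]
    exact_mod_cast Fintype.card_pos
  set χ := AddChar.FiniteField.primitiveChar_to_Complex F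
  have hχ : χ.IsPrimitive := AddChar.FiniteField.primitiveChar_to_Complex_isPrimitive F
  have hχ1 : χ ≠ 1 := by
    have := hχ one_ne_zero
    rwa [AddChar.mulShift_one] at this
  set S : F → ℂ := fun r => ∑ x ∈ Fintype.piFinset (fun _ : Fin k => E),
    χ (r * ∑ j, a j * (∑ i, x i) j ^ s) with hS
  set B : ℝ := ((s - 1 : ℝ) ^ 2) ^ d * q ^ d * (energy E (k - 1) * energy E (k + 1)) with hB
  have hSr : ∀ r, r ≠ 0 → ‖S r‖ ^ 2 ≤ B := by
    intro r hr
    refine (norm_sq_sum_piFinset_le hχ E hk (fun z => χ (r * ∑ j, a j * z j ^ s))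
      (norm_sum_addChar_diagonal_le hχ1 ha hs hsF hr)).trans_eq ?_
    rw [hB, ← pow_mul, mul_comm d 2, pow_mul, mul_pow, Real.sq_sqrt hq0.le, mul_pow]
  have hX : ∑ r, ‖∑ b ∈ X, χ (r * b)‖ ^ 2 = q * X.card := by
    have h := card_mul_sum_norm_sq hχ (fun t => if t ∈ X then 1 else 0)
    simp only [ite_mul, one_mul, zero_mul, sum_ite_mem, univ_inter] at h
    rw [← h]
    congr 1
    simp [apply_ite norm, ite_pow]
  have hnu := card_mul_sum_norm_sq hχ (fun t => (nuP a s E X k t : ℂ))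
  simp only [sum_nuP_mul_addChar, Complex.norm_natCast, norm_mul, mul_pow] at hnu
  have hzero : ‖∑ b ∈ X, χ (0 * b)‖ ^ 2 * ‖S 0‖ ^ 2 = (X.card : ℝ) ^ 2 * (E.card : ℝ) ^ (2 * k) := by
    simp [hS, pow_mul, mul_comm 2 k]
  have hbound : q * ∑ t, (nuP a s E X k t : ℝ) ^ 2 ≤
      (X.card : ℝ) ^ 2 * (E.card : ℝ) ^ (2 * k) + q * X.card * B := by
    rw [hnu, ← add_sum_erase _ _ (mem_univ (0 : F)), ← hzero, ← hX, sum_mul]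
    gcongr
    refine (sum_le_sum fun r hr => mul_le_mul_of_nonneg_left (hSr r (ne_of_mem_erase hr))
      (by positivity)).trans ?_
    exact sum_le_sum_of_subset_of_nonneg (erase_subset _ _) fun _ _ _ => by positivity
  rw [← mul_le_mul_iff_right₀ hq0]
  refine hbound.trans_eq ?_
  rw [hB]
  field_simp
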